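/- For every β ≥ 0, lim_{d→∞} √d · limsup_{n→∞} E_A[⟨((1/n) Σ_{i=1}^n σ(i))²⟩_{β/√d,A}] = 0, where the Gibbs average is over a sample from μ_{β/√d,A} and the expectation is over the sparse disorder A. -/

import Mathlib

open MeasureTheory ProbabilityTheory Filter

noncomputable section

/-- The value of a ±1 spin encoded as a Boolean. -/
def spin (b : Bool) : ℝ := if b then 1 else -1

/-- The Ising Hamiltonian `H(σ; X) = ∑_{i,j} X i j σ(i) σ(j)`. -/
def Ham {n : ℕ} (X : Fin n → Fin n → ℝ) (σ : Fin n → Bool) : ℝ :=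
  ∑ i, ∑ j, X i j * spin (σ i) * spin (σ j)

/-- The partition function `Z(β, X)`. -/
def Zpart {n : ℕ} (β : ℝ) (X : Fin n → Fin n → ℝ) : ℝ :=
  ∑ σ : Fin n → Bool, Real.exp (-β * Ham X σ)

/-- The Gibbs probability mass function `μ_{β,X}(σ)`. -/
def gibbs {n : ℕ} (β : ℝ) (X : Fin n → Fin n → ℝ) (σ : Fin n → Bool) : ℝ :=
  Real.exp (-β * Ham X σ) / Zpart β X

/-- A configuration is a bisection if `|∑ i σ(i)| ≤ 1`. -/
def isBis {n : ℕ} (σ : Fin n → Bool) : Prop := |∑ i, spin (σ i)| ≤ 1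

open scoped Classical in
/-- The bisection partition function `Z^bis(β, X)`. -/
def ZpartBis {n : ℕ} (β : ℝ) (X : Fin n → Fin n → ℝ) : ℝ :=
  ∑ σ : Fin n → Bool, if isBis σ then Real.exp (-β * Ham X σ) else 0

open scoped Classical in
/-- The bisection Gibbs probability mass function `μ^bis_{β,X}(σ)`. -/
def gibbsBis {n : ℕ} (β : ℝ) (X : Fin n → Fin n → ℝ) (σ : Fin n → Bool) : ℝ :=
  if isBis σ then Real.exp (-β * Ham X σ) / ZpartBis β X else 0

/-- The overlap `R_{1,2}(σ1, σ2) = (1/n) ∑ i σ1(i) σ2(i)`. -/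
def overlap {n : ℕ} (σ1 σ2 : Fin n → Bool) : ℝ :=
  (1 / (n : ℝ)) * ∑ i, spin (σ1 i) * spin (σ2 i)

/-- Gibbs average of a one-variable observable. -/
def avg1 {n : ℕ} (β : ℝ) (X : Fin n → Fin n → ℝ) (f : (Fin n → Bool) → ℝ) : ℝ :=
  ∑ σ : Fin n → Bool, f σ * gibbs β X σ

/-- Bisection Gibbs average of a one-variable observable. -/
def avg1Bis {n : ℕ} (β : ℝ) (X : Fin n → Fin n → ℝ) (f : (Fin n → Bool) → ℝ) : ℝ :=
  ∑ σ : Fin n → Bool, f σ * gibbsBis β X σ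

/-- Coupled Gibbs average: `σ1 ~ μ_{β,X}`, `σ2 ~ μ_{β,Y}` independent. -/
def avg2c {n : ℕ} (β : ℝ) (X Y : Fin n → Fin n → ℝ)
    (f : (Fin n → Bool) → (Fin n → Bool) → ℝ) : ℝ :=
  ∑ σ1 : Fin n → Bool, ∑ σ2 : Fin n → Bool, f σ1 σ2 * gibbs β X σ1 * gibbs β Y σ2

/-- Gibbs average of a two-replica observable. -/
def avg2 {n : ℕ} (β : ℝ) (X : Fin n → Fin n → ℝ)
    (f : (Fin n → Bool) → (Fin n → Bool) → ℝ) : ℝ :=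
  avg2c β X X f

/-- Coupled bisection Gibbs average. -/
def avg2cBis {n : ℕ} (β : ℝ) (X Y : Fin n → Fin n → ℝ)
    (f : (Fin n → Bool) → (Fin n → Bool) → ℝ) : ℝ :=
  ∑ σ1 : Fin n → Bool, ∑ σ2 : Fin n → Bool, f σ1 σ2 * gibbsBis β X σ1 * gibbsBis β Y σ2

/-- Bisection Gibbs average of a two-replica observable. -/
def avg2Bis {n : ℕ} (β : ℝ) (X : Fin n → Fin n → ℝ)
    (f : (Fin n → Bool) → (Fin n → Bool) → ℝ) : ℝ :=
  avg2cBis β X X f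

/-- The SK disorder: i.i.d. entries `N(0, 1/(2n))`. -/
def skMeasure (n : ℕ) : Measure (Fin n → Fin n → ℝ) :=
  Measure.pi fun _ => Measure.pi fun _ => gaussianReal 0 (1 / (2 * n))

/-- The law of the pair `(g, g')` of independent SK disorders. -/
def skPair (n : ℕ) : Measure ((Fin n → Fin n → ℝ) × (Fin n → Fin n → ℝ)) :=
  (skMeasure n).prod (skMeasure n)

/-- The perturbed SK disorder `g_t = √(1-t) g + √t g'`. -/
def skPerturb {n : ℕ} (t : ℝ) (g g' : Fin n → Fin n → ℝ) : Fin n → Fin n → ℝ :=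
  fun i j => Real.sqrt (1 - t) * g i j + Real.sqrt t * g' i j

/-- The sparse disorder: i.i.d. entries `Poisson(d/(2n))`. -/
def sparseMeasure (n : ℕ) (d : ℝ) : Measure (Fin n → Fin n → ℕ) :=
  Measure.pi fun _ => Measure.pi fun _ => poissonMeasure (d / (2 * n)).toNNReal

/-- The law of the triple `(A^{(1-t)}, A^{(t,1)}, A^{(t,2)})` of independent sparse disorders
used to build the coupled pair `A = A^{(1-t)} + A^{(t,1)}`, `A_t = A^{(1-t)} + A^{(t,2)}`. -/
def coupledSparse (n : ℕ) (d t : ℝ) :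
    Measure ((Fin n → Fin n → ℕ) × (Fin n → Fin n → ℕ) × (Fin n → Fin n → ℕ)) :=
  (sparseMeasure n ((1 - t) * d)).prod
    ((sparseMeasure n (t * d)).prod (sparseMeasure n (t * d)))

/-- View an ℕ-valued matrix as a real matrix. -/
def natMat {n : ℕ} (A : Fin n → Fin n → ℕ) : Fin n → Fin n → ℝ := fun i j => (A i j : ℝ)

/-- The Gibbs measure `μ_{β,X}` as a probability measure on configurations. -/
def gibbsMeasure {n : ℕ} (β : ℝ) (X : Fin n → Fin n → ℝ) : Measure (Fin n → Bool) :=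
  ∑ σ : Fin n → Bool, ENNReal.ofReal (gibbs β X σ) • Measure.dirac σ

/-- The bisection Gibbs measure `μ^bis_{β,X}` as a measure on configurations. -/
def gibbsBisMeasure {n : ℕ} (β : ℝ) (X : Fin n → Fin n → ℝ) : Measure (Fin n → Bool) :=
  ∑ σ : Fin n → Bool, ENNReal.ofReal (gibbsBis β X σ) • Measure.dirac σ

/-- Normalized Wasserstein distance `W_{2,n}` between measures on `{-1,1}^n`. -/
def W2 (n : ℕ) (μ1 μ2 : Measure (Fin n → Bool)) : ℝ :=
  sInf {r : ℝ | ∃ π : Measure ((Fin n → Bool) × (Fin n → Bool)),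
    IsProbabilityMeasure π ∧ π.map Prod.fst = μ1 ∧ π.map Prod.snd = μ2 ∧
    r = Real.sqrt (∫ p, (1 / (n : ℝ)) * ∑ i, (spin (p.1 i) - spin (p.2 i)) ^ 2 ∂π)}

open scoped Classical in
/-- Overlap-restricted coupled partition function `Z^S_{X,Y}`. -/
def Zres {n : ℕ} (β : ℝ) (S : Set ℝ) (X Y : Fin n → Fin n → ℝ) : ℝ :=
  ∑ σ1 : Fin n → Bool, ∑ σ2 : Fin n → Bool,
    if overlap σ1 σ2 ∈ S then Real.exp (-β * (Ham X σ1 + Ham Y σ2)) else 0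

open scoped Classical in
/-- Overlap-restricted coupled bisection partition function `Z^{S,bis}_{X,Y}`. -/
def ZresBis {n : ℕ} (β : ℝ) (S : Set ℝ) (X Y : Fin n → Fin n → ℝ) : ℝ :=
  ∑ σ1 : Fin n → Bool, ∑ σ2 : Fin n → Bool,
    if isBis σ1 ∧ isBis σ2 ∧ overlap σ1 σ2 ∈ S
    then Real.exp (-β * (Ham X σ1 + Ham Y σ2)) else 0

/-- The matrix with a single `1` in position `(i,j)`. -/
def Jmat {n : ℕ} (i j : Fin n) : Fin n → Fin n → ℝ :=
  fun a b => if a = i ∧ b = j then 1 else 0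

end

noncomputable section

lemma abs_spin (b : Bool) : |spin b| = 1 := by cases b <;> simp [spin]

lemma spin_not (b : Bool) : spin (!b) = -spin b := by cases b <;> simp [spin]

/-- The normalized magnetization of a configuration. -/
def magnetization {n : ℕ} (σ : Fin n → Bool) : ℝ := (1 / (n : ℝ)) * ∑ i, spin (σ i)

/-- The local field acting on the spin at `i`, without the diagonal term. -/
def localField {n : ℕ} (X : Fin n → Fin n → ℝ) (σ : Fin n → Bool) (i : Fin n) : ℝ :=
  ∑ j, if j = i then 0 else (X i j + X j i) * spin (σ j)

/-- The configuration with the spin at `i` reversed. -/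
def flipAt {n : ℕ} (i : Fin n) (σ : Fin n → Bool) : Fin n → Bool :=
  Function.update σ i (!σ i)

lemma flipAt_involutive {n : ℕ} (i : Fin n) : Function.Involutive (flipAt i) := by
  intro σ
  simp [flipAt]

lemma spin_flipAt {n : ℕ} (i j : Fin n) (σ : Fin n → Bool) :
    spin (flipAt i σ j) = spin (σ j) - if j = i then 2 * spin (σ j) else 0 := by
  by_cases h : j = i
  · subst h
    simp only [flipAt, Function.update_self, spin_not, if_true]
    ring
  · simp [flipAt, h]

lemma localField_flipAt {n : ℕ} (X : Fin n → Fin n → ℝ) (σ : Fin n → Bool) (i : Fin n) :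
    localField X (flipAt i σ) i = localField X σ i := by
  refine Finset.sum_congr rfl fun j _ => ?_
  by_cases h : j = i <;> simp [h, spin_flipAt]

lemma spin_mul_localField {n : ℕ} (X : Fin n → Fin n → ℝ) (σ : Fin n → Bool) (i : Fin n) :
    spin (σ i) * localField X σ i =
      ∑ j, X i j * spin (σ i) * spin (σ j) + ∑ j, X j i * spin (σ j) * spin (σ i)
        - 2 * (X i i * spin (σ i) * spin (σ i)) := by
  have h : 2 * (X i i * spin (σ i) * spin (σ i)) =
      ∑ j, if j = i then 2 * (X i i * spin (σ i) * spin (σ i)) else 0 := by simp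
  rw [h, localField, Finset.mul_sum, ← Finset.sum_add_distrib, ← Finset.sum_sub_distrib]
  refine Finset.sum_congr rfl fun j _ => ?_
  by_cases hj : j = i
  · subst hj; simp; ring
  · simp [hj]; ring

lemma Ham_flipAt {n : ℕ} (X : Fin n → Fin n → ℝ) (σ : Fin n → Bool) (i : Fin n) :
    Ham X (flipAt i σ) = Ham X σ - 2 * (spin (σ i) * localField X σ i) := by
  have key : ∀ a b, X a b * spin (flipAt i σ a) * spin (flipAt i σ b) =
      X a b * spin (σ a) * spin (σ b)
        - 2 * (if a = i then X a b * spin (σ a) * spin (σ b) else 0)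
        - 2 * (if b = i then X a b * spin (σ a) * spin (σ b) else 0)
        + 4 * (if a = i then (if b = i then X a b * spin (σ a) * spin (σ b) else 0) else 0) := by
    intro a b
    rw [spin_flipAt, spin_flipAt]
    split_ifs <;> ring
  rw [spin_mul_localField, Ham, Ham]
  simp only [key, Finset.sum_add_distrib, Finset.sum_sub_distrib, ← Finset.mul_sum]
  have h : ∀ F : Fin n → Fin n → ℝ,
      ∑ a, ∑ b, (if a = i then F a b else 0) = ∑ b, F i b := by
    intro F
    rw [Finset.sum_comm]
    simp
  rw [h, h]
  simp
  ring

lemma Zpart_pos {n : ℕ} (b : ℝ) (X : Fin n → Fin n → ℝ) : 0 < Zpart b X :=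
  Finset.sum_pos (fun _ _ => Real.exp_pos _) Finset.univ_nonempty

lemma gibbs_nonneg {n : ℕ} (b : ℝ) (X : Fin n → Fin n → ℝ) (σ : Fin n → Bool) :
    0 ≤ gibbs b X σ :=
  div_nonneg (Real.exp_pos _).le (Zpart_pos b X).le

lemma sum_gibbs {n : ℕ} (b : ℝ) (X : Fin n → Fin n → ℝ) : ∑ σ, gibbs b X σ = 1 := by
  simp only [gibbs]
  rw [← Finset.sum_div]
  exact div_self (Zpart_pos b X).ne'

lemma avg1_mono {n : ℕ} {b : ℝ} {X : Fin n → Fin n → ℝ} {f g : (Fin n → Bool) → ℝ}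
    (h : ∀ σ, f σ ≤ g σ) : avg1 b X f ≤ avg1 b X g :=
  Finset.sum_le_sum fun σ _ => mul_le_mul_of_nonneg_right (h σ) (gibbs_nonneg b X σ)

lemma avg1_const {n : ℕ} (b : ℝ) (X : Fin n → Fin n → ℝ) (c : ℝ) :
    avg1 b X (fun _ => c) = c := by
  rw [avg1, ← Finset.mul_sum, sum_gibbs, mul_one]

lemma avg1_add {n : ℕ} (b : ℝ) (X : Fin n → Fin n → ℝ) (f g : (Fin n → Bool) → ℝ) :
    avg1 b X (fun σ => f σ + g σ) = avg1 b X f + avg1 b X g := by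
  simp only [avg1, add_mul, Finset.sum_add_distrib]

lemma avg1_mul_left {n : ℕ} (b : ℝ) (X : Fin n → Fin n → ℝ) (c : ℝ) (f : (Fin n → Bool) → ℝ) :
    avg1 b X (fun σ => c * f σ) = c * avg1 b X f := by
  simp only [avg1, Finset.mul_sum, mul_assoc]

lemma avg1_sum {n : ℕ} {ι : Type*} (s : Finset ι) (b : ℝ) (X : Fin n → Fin n → ℝ)
    (f : ι → (Fin n → Bool) → ℝ) :
    avg1 b X (fun σ => ∑ i ∈ s, f i σ) = ∑ i ∈ s, avg1 b X (f i) := by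
  simp only [avg1, Finset.sum_mul]
  exact Finset.sum_comm

/-- The Callen identity: under the Gibbs measure a spin may be replaced by its conditional mean
against any observable that does not depend on it. -/
lemma avg1_spin_add_tanh_mul {n : ℕ} (b : ℝ) (X : Fin n → Fin n → ℝ) (i : Fin n)
    (F : (Fin n → Bool) → ℝ) (hF : ∀ σ, F (flipAt i σ) = F σ) :
    avg1 b X (fun σ => (spin (σ i) + Real.tanh (b * localField X σ i)) * F σ) = 0 := by
  set T : (Fin n → Bool) → ℝ := fun σ =>
    (spin (σ i) + Real.tanh (b * localField X σ i)) * F σ * gibbs b X σ with hT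
  have hanti : ∀ σ, T (flipAt i σ) = -T σ := by
    intro σ
    have hs : spin (flipAt i σ i) = -spin (σ i) := by simp [flipAt, spin_not]
    have hc : Real.cosh (b * localField X σ i) ≠ 0 := (Real.cosh_pos _).ne'
    have he : Real.exp (-b * Ham X (flipAt i σ)) = Real.exp (-b * Ham X σ) *
        (Real.exp (b * (spin (σ i) * localField X σ i)) *
          Real.exp (b * (spin (σ i) * localField X σ i))) := by
      rw [← Real.exp_add, ← Real.exp_add, Ham_flipAt]
      congr 1
      ring
    have hk : (-spin (σ i) + Real.tanh (b * localField X σ i)) *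
        (Real.exp (b * (spin (σ i) * localField X σ i)) *
          Real.exp (b * (spin (σ i) * localField X σ i))) =
        -(spin (σ i) + Real.tanh (b * localField X σ i)) := by
      generalize hy : b * localField X σ i = y at hc ⊢
      have hpm : spin (σ i) = 1 ∨ spin (σ i) = -1 := by
        cases σ i <;> simp [spin]
      have e1 : Real.exp y * Real.exp (-y) = 1 := by rw [← Real.exp_add]; simp
      have hc' : Real.exp y + Real.exp (-y) ≠ 0 := by positivity
      have hy' : b * (spin (σ i) * localField X σ i) = spin (σ i) * y := by rw [← hy]; ring
      rw [hy', Real.tanh_eq_sinh_div_cosh, Real.sinh_eq, Real.cosh_eq]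
      rcases hpm with h | h <;> rw [h]
      · rw [one_mul]
        field_simp
        linear_combination (-2 * Real.exp y) * e1
      · rw [neg_one_mul]
        field_simp
        linear_combination (2 * Real.exp (-y)) * e1
    simp only [hT, hs, localField_flipAt, hF, gibbs, he]
    linear_combination (F σ * Real.exp (-b * Ham X σ) / Zpart b X) * hk
  have hsum : ∑ σ, T (flipAt i σ) = ∑ σ, T σ :=
    (flipAt_involutive i).bijective.sum_comp T
  have : avg1 b X (fun σ => (spin (σ i) + Real.tanh (b * localField X σ i)) * F σ) = ∑ σ, T σ := rfl
  rw [this]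
  simp only [hanti, Finset.sum_neg_distrib] at hsum
  linarith

lemma abs_magnetization_le_one {n : ℕ} (σ : Fin n → Bool) : |magnetization σ| ≤ 1 := by
  rw [magnetization, abs_mul, abs_of_nonneg (by positivity : (0 : ℝ) ≤ 1 / n)]
  have h : |∑ i, spin (σ i)| ≤ n :=
    (Finset.abs_sum_le_sum_abs _ _).trans (by simp [abs_spin])
  calc (1 / (n : ℝ)) * |∑ i, spin (σ i)| ≤ (1 / (n : ℝ)) * n := by gcongr
    _ ≤ 1 := by rw [one_div_mul_eq_div]; exact div_self_le_one _

lemma magnetization_flipAt {n : ℕ} (i : Fin n) (σ : Fin n → Bool) :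
    magnetization (flipAt i σ) - spin (flipAt i σ i) / n = magnetization σ - spin (σ i) / n := by
  have hs : spin (flipAt i σ i) = -spin (σ i) := by simp [flipAt, spin_not]
  rw [hs, magnetization, magnetization]
  simp only [spin_flipAt, Finset.sum_sub_distrib, Finset.sum_ite_eq', Finset.mem_univ, if_true]
  ring

lemma abs_mul_abs_sub_mul_abs_le (x y : ℝ) : |(x * |x| - y * |y|)| ≤ |x - y| * (|x| + |y|) := by
  have h : x * |x| - y * |y| = (x - y) * |x| + y * (|x| - |y|) := by ring
  rw [h]
  calc |((x - y) * |x| + y * (|x| - |y|))| ≤ |x - y| * |x| + |y| * |(|x| - |y|)| := by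
        refine (abs_add_le _ _).trans_eq ?_
        rw [abs_mul, abs_mul, abs_abs]
    _ ≤ |x - y| * |x| + |y| * |x - y| := 
        add_le_add le_rfl (mul_le_mul_of_nonneg_left (abs_abs_sub_abs_le_abs_sub x y) (abs_nonneg y))
    _ = _ := by ring

lemma avg1_abs_magnetization_cube_add_le {n : ℕ} (hn : 0 < n) (b : ℝ) (X : Fin n → Fin n → ℝ) :
    avg1 b X (fun σ => |magnetization σ| ^ 3 + (1 / (n : ℝ)) *
      ∑ i, Real.tanh (b * localField X σ i) * (magnetization σ * |magnetization σ|)) ≤ 6 / n := by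
  have hn' : (0 : ℝ) < n := by exact_mod_cast hn
  set F : Fin n → (Fin n → Bool) → ℝ := fun i σ =>
    (magnetization σ - spin (σ i) / n) * |magnetization σ - spin (σ i) / n| with hF
  have hpt : ∀ σ : Fin n → Bool, |magnetization σ| ^ 3 + (1 / (n : ℝ)) *
      ∑ i, Real.tanh (b * localField X σ i) * (magnetization σ * |magnetization σ|) ≤
      (1 / (n : ℝ)) * ∑ i, (spin (σ i) + Real.tanh (b * localField X σ i)) * F i σ + 6 / n := by
    intro σ
    have h1 : |magnetization σ| ^ 3 =
        (1 / (n : ℝ)) * ∑ i, spin (σ i) * (magnetization σ * |magnetization σ|) := by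
      rw [← Finset.sum_mul, ← mul_assoc, ← magnetization, pow_succ, sq_abs]
      ring
    have h2 : (6 : ℝ) / n = (1 / (n : ℝ)) * ∑ _i : Fin n, 6 / (n : ℝ) := by
      simp only [Finset.sum_const, Finset.card_univ, Fintype.card_fin, nsmul_eq_mul]
      field_simp
    rw [h1, h2, ← mul_add, ← mul_add, ← Finset.sum_add_distrib, ← Finset.sum_add_distrib]
    refine mul_le_mul_of_nonneg_left (Finset.sum_le_sum fun i _ => ?_) (by positivity)
    rw [← add_mul]
    have hm := abs_magnetization_le_one σ
    have hsn : |spin (σ i) / n| = 1 / n := by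
      rw [abs_div, abs_spin, abs_of_pos hn']
    have hn1 : 1 / (n : ℝ) ≤ 1 := by
      rw [div_le_one hn']
      exact_mod_cast hn
    have hmi : |magnetization σ - spin (σ i) / n| ≤ 2 := by
      refine (abs_sub _ _).trans ?_
      rw [hsn]
      linarith
    have hd : |(magnetization σ * |magnetization σ| - F i σ)| ≤ 3 / n := by
      refine (abs_mul_abs_sub_mul_abs_le _ _).trans ?_
      rw [sub_sub_cancel, hsn]
      calc 1 / (n : ℝ) * (|magnetization σ| + |magnetization σ - spin (σ i) / n|)
          ≤ 1 / n * 3 := by gcongr; linarith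
        _ = 3 / n := by ring
    have hc : |spin (σ i) + Real.tanh (b * localField X σ i)| ≤ 2 := by
      refine (abs_add_le _ _).trans ?_
      rw [abs_spin]
      linarith [Real.abs_tanh_lt_one (b * localField X σ i)]
    have hp := mul_le_mul hc hd (abs_nonneg _) (by norm_num)
    rw [← abs_mul] at hp
    have hp' := (le_abs_self _).trans hp
    have h6 : (6 : ℝ) / n = 2 * (3 / n) := by ring
    rw [h6]
    linarith
  refine (avg1_mono hpt).trans_eq ?_
  rw [avg1_add, avg1_const, avg1_mul_left, avg1_sum]
  rw [Finset.sum_eq_zero fun i _ => avg1_spin_add_tanh_mul b X i (F i) fun σ => ?_]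
  · simp
  · simp only [hF, magnetization_flipAt]

lemma tanh_mono {x y : ℝ} (h : x ≤ y) : Real.tanh x ≤ Real.tanh y := by
  rw [← Real.artanh_le_artanh_iff ⟨Real.neg_one_lt_tanh x, Real.tanh_lt_one x⟩
    ⟨Real.neg_one_lt_tanh y, Real.tanh_lt_one y⟩]
  simpa [Real.artanh_tanh] using h

lemma neg_tanh_mul_sq_le {β r h m : ℝ} (hβ : 0 ≤ β) (hr : 0 < r) (hm : 0 ≤ m) :
    -(Real.tanh (β / r * h) * m ^ 2) ≤
      -(Real.tanh (β / 2) * m ^ 2) + 4 * m * |h - r ^ 2 * m| / r ^ 2 + 2 / r ^ 2 := by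
  have ht1 := Real.neg_one_lt_tanh (β / r * h)
  have ht2 := Real.tanh_lt_one (β / 2)
  have hA : 0 ≤ 4 * m * |h - r ^ 2 * m| / r ^ 2 := by positivity
  have hB : 0 ≤ 2 / r ^ 2 := by positivity
  have hm2 : 0 ≤ m ^ 2 := sq_nonneg m
  by_cases h1 : r * m ≤ 1
  · have : 2 * m ^ 2 ≤ 2 / r ^ 2 := by
      rw [le_div_iff₀ (by positivity)]
      nlinarith [mul_nonneg hr.le hm]
    nlinarith
  · push Not at h1
    by_cases h2 : |h - r ^ 2 * m| ≤ r ^ 2 * m / 2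
    · have h3 : r * (r * m) / 2 ≤ h := by
        have := (abs_le.mp h2).1
        nlinarith
      have h4 : β / 2 ≤ β / r * h := by
        calc β / 2 ≤ β * (r * m) / 2 := by nlinarith
          _ = β / r * (r * (r * m) / 2) := by field_simp
          _ ≤ β / r * h := by gcongr
      have := mul_le_mul_of_nonneg_right (tanh_mono h4) hm2
      linarith
    · push Not at h2
      have : 2 * m ^ 2 ≤ 4 * m * |h - r ^ 2 * m| / r ^ 2 := by
        rw [le_div_iff₀ (by positivity)]
        nlinarith
      nlinarith

lemma neg_tanh_mul_mul_abs_le {β r : ℝ} (hβ : 0 ≤ β) (hr : 0 < r) (h m : ℝ) :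
    -(Real.tanh (β / r * h) * (m * |m|)) ≤
      -(Real.tanh (β / 2) * m ^ 2) + 4 * |m| * |h - r ^ 2 * m| / r ^ 2 + 2 / r ^ 2 := by
  rcases le_total 0 m with hm | hm
  · rw [abs_of_nonneg hm, ← sq]
    exact neg_tanh_mul_sq_le hβ hr hm
  · have := neg_tanh_mul_sq_le (h := -h) hβ hr (neg_nonneg.mpr hm)
    rw [abs_of_nonpos hm]
    rw [mul_neg, Real.tanh_neg, show -h - r ^ 2 * -m = -(h - r ^ 2 * m) by ring, abs_neg,
      neg_sq] at this
    linarith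

/-- If the local fields are on average within `5 √d` of their mean values, uniformly over
configurations, then the squared magnetization is of order `1 / d`. -/
lemma exists_avg1_magnetization_sq_le {β : ℝ} (hβ : 0 ≤ β) :
    ∃ K : ℝ, ∀ r : ℝ, 1 ≤ r → ∀ n : ℕ, 0 < n → ∀ X : Fin n → Fin n → ℝ,
      (∀ σ, ∑ i, |localField X σ i - r ^ 2 * magnetization σ| ≤ 5 * n * r) →
      avg1 (β / r) X (fun σ => magnetization σ ^ 2) ≤ K / r ^ 2 + K * r ^ 2 / n := by
  rcases hβ.eq_or_lt with rfl | hβ'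
  · refine ⟨6, fun r hr n hn X _ => ?_⟩
    have h := avg1_abs_magnetization_cube_add_le hn (0 / r) X
    simp only [zero_div, zero_mul, Real.tanh_zero, Finset.sum_const_zero, mul_zero,
      add_zero] at h ⊢
    have hr0 : 0 < r := by linarith
    have hpt : ∀ σ : Fin n → Bool,
        magnetization σ ^ 2 ≤ r ^ 2 * |magnetization σ| ^ 3 + 6 / r ^ 2 := by
      intro σ
      rw [← sq_abs]
      have hm : 0 ≤ |magnetization σ| := abs_nonneg _
      generalize |magnetization σ| = m at hm
      by_cases hrm : r * m ≤ 1
      · have : m ^ 2 ≤ 6 / r ^ 2 := by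
          rw [le_div_iff₀ (by positivity)]
          nlinarith [mul_nonneg hr0.le hm]
        have : 0 ≤ r ^ 2 * m ^ 3 := by positivity
        linarith
      · have h1 : 1 ≤ r * (r * m) := by nlinarith
        have h2 := mul_le_mul_of_nonneg_right h1 (sq_nonneg m)
        have h3 : 0 ≤ 6 / r ^ 2 := by positivity
        linarith
    refine (avg1_mono hpt).trans ?_
    rw [avg1_add, avg1_const, avg1_mul_left]
    have := mul_le_mul_of_nonneg_left h (sq_nonneg r)
    have e : r ^ 2 * (6 / n) = 6 * r ^ 2 / n := by ring
    linarith
  · set c := Real.tanh (β / 2) with hc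
    have hc0 : 0 < c := by
      rw [hc, Real.tanh_eq_sinh_div_cosh]
      exact div_pos (Real.sinh_pos_iff.mpr (by linarith)) (Real.cosh_pos _)
    refine ⟨2 / c * (200 / c + 8), fun r hr n hn X hX => ?_⟩
    have hr0 : 0 < r := by linarith
    have hn' : (0 : ℝ) < n := by exact_mod_cast hn
    have h := avg1_abs_magnetization_cube_add_le hn (β / r) X
    have hpt : ∀ σ : Fin n → Bool, magnetization σ ^ 2 ≤ 2 / c * (|magnetization σ| ^ 3 +
        (1 / (n : ℝ)) * ∑ i, Real.tanh (β / r * localField X σ i) *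
          (magnetization σ * |magnetization σ|)) + 2 / c * ((200 / c + 2) / r ^ 2) := by
      intro σ
      have h1 : -∑ i, Real.tanh (β / r * localField X σ i) *
          (magnetization σ * |magnetization σ|) ≤
          n * (-(c * magnetization σ ^ 2) + 2 / r ^ 2) + 20 * n * |magnetization σ| / r := by
        rw [← Finset.sum_neg_distrib]
        calc _ ≤ ∑ i, ((-(c * magnetization σ ^ 2) + 2 / r ^ 2) +
              4 * |magnetization σ| / r ^ 2 *
                |localField X σ i - r ^ 2 * magnetization σ|) := by
              refine Finset.sum_le_sum fun i _ => ?_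
              refine (neg_tanh_mul_mul_abs_le hβ hr0 _ _).trans_eq ?_
              rw [← hc]
              ring
          _ = n * (-(c * magnetization σ ^ 2) + 2 / r ^ 2) + 4 * |magnetization σ| / r ^ 2 *
                ∑ i, |localField X σ i - r ^ 2 * magnetization σ| := by
              rw [Finset.sum_add_distrib, ← Finset.mul_sum, Finset.sum_const, Finset.card_univ,
                Fintype.card_fin, nsmul_eq_mul]
          _ ≤ n * (-(c * magnetization σ ^ 2) + 2 / r ^ 2) + 4 * |magnetization σ| / r ^ 2 *
                (5 * n * r) := by
              gcongr
              exact hX σ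
          _ = _ := by
              field_simp
              ring
      have h2 := mul_le_mul_of_nonneg_left h1 (by positivity : (0 : ℝ) ≤ 1 / n)
      have h3 : (1 / (n : ℝ)) * (n * (-(c * magnetization σ ^ 2) + 2 / r ^ 2) +
          20 * n * |magnetization σ| / r) =
          -(c * magnetization σ ^ 2) + 2 / r ^ 2 + 20 * (|magnetization σ| / r) := by
        field_simp
      rw [h3, mul_neg] at h2
      have h4 : 20 * (|magnetization σ| / r) ≤
          c / 2 * magnetization σ ^ 2 + 200 / c / r ^ 2 := by
        have : c / 2 * magnetization σ ^ 2 + 200 / c / r ^ 2 - 20 * (|magnetization σ| / r) =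
            (c * |magnetization σ| - 20 / r) ^ 2 / (2 * c) := by
          rw [← sq_abs (magnetization σ)]
          field_simp
          ring
        have h5 : 0 ≤ (c * |magnetization σ| - 20 / r) ^ 2 / (2 * c) := by positivity
        linarith
      have h6 : 0 ≤ |magnetization σ| ^ 3 := by positivity
      have h7 : c / 2 * magnetization σ ^ 2 ≤ (|magnetization σ| ^ 3 +
        (1 / (n : ℝ)) * ∑ i, Real.tanh (β / r * localField X σ i) *
          (magnetization σ * |magnetization σ|)) + (200 / c + 2) / r ^ 2 := by
        rw [add_div]
        linarith
      rw [← mul_add]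
      calc magnetization σ ^ 2 = 2 / c * (c / 2 * magnetization σ ^ 2) := by field_simp
        _ ≤ _ := by gcongr
    refine (avg1_mono hpt).trans ?_
    rw [avg1_add, avg1_const, avg1_mul_left]
    have h8 : 6 / (n : ℝ) ≤ (200 / c + 8) * r ^ 2 / n := by
      gcongr
      have : 0 ≤ 200 / c := by positivity
      nlinarith
    calc _ ≤ 2 / c * ((200 / c + 8) * r ^ 2 / n) + 2 / c * ((200 / c + 8) / r ^ 2) := by
          gcongr
          · exact h.trans h8
          · norm_num
      _ = _ := by ring

lemma hasSum_poisson_exp_mul (q : NNReal) (s : ℝ) :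
    HasSum (fun k : ℕ => Real.exp (-q) * (q : ℝ) ^ k / (k.factorial : ℝ) * Real.exp (s * k))
      (Real.exp (q * (Real.exp s - 1))) := by
  have h := (NormedSpace.expSeries_div_hasSum_exp ((q : ℝ) * Real.exp s)).mul_left (Real.exp (-q))
  rw [← Real.exp_eq_exp_ℝ, ← Real.exp_add] at h
  convert! h using 1
  · ext k
    rw [mul_pow, ← Real.exp_nat_mul, mul_comm s]
    ring
  · congr 1
    ring

lemma integrable_exp_mul_poissonMeasure (q : NNReal) (s : ℝ) :
    Integrable (fun k : ℕ => Real.exp (s * k)) (poissonMeasure q) := by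
  rw [integrable_poissonMeasure_iff]
  simpa only [Real.norm_eq_abs, Real.abs_exp] using (hasSum_poisson_exp_mul q s).summable

lemma integral_exp_mul_poissonMeasure (q : NNReal) (s : ℝ) :
    ∫ k : ℕ, Real.exp (s * k) ∂(poissonMeasure q) = Real.exp (q * (Real.exp s - 1)) := by
  rw [integral_poissonMeasure]
  simpa only [smul_eq_mul] using (hasSum_poisson_exp_mul q s).tsum_eq

instance isProbabilityMeasure_sparseMeasure {n : ℕ} {d : ℝ} :
    IsProbabilityMeasure (sparseMeasure n d) := by
  unfold sparseMeasure
  infer_instance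

lemma integrable_exp_sum_sparseMeasure {n : ℕ} (d : ℝ) (c : Fin n → Fin n → ℝ) :
    Integrable (fun A : Fin n → Fin n → ℕ => Real.exp (∑ i, ∑ j, c i j * A i j))
      (sparseMeasure n d) := by
  simp only [Real.exp_sum]
  exact Integrable.fintype_prod
    (f := fun i (a : Fin n → ℕ) => ∏ j, Real.exp (c i j * a j)) fun i =>
      Integrable.fintype_prod (f := fun j (k : ℕ) => Real.exp (c i j * k)) fun j =>
        integrable_exp_mul_poissonMeasure _ _

lemma integral_exp_sum_sparseMeasure {n : ℕ} {d : ℝ} (hd : 0 ≤ d) (c : Fin n → Fin n → ℝ) :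
    ∫ A : Fin n → Fin n → ℕ, Real.exp (∑ i, ∑ j, c i j * A i j) ∂(sparseMeasure n d) =
      Real.exp (∑ i, ∑ j, d / (2 * n) * (Real.exp (c i j) - 1)) := by
  simp only [Real.exp_sum, sparseMeasure]
  rw [integral_fintype_prod_eq_prod (fun i (a : Fin n → ℕ) => ∏ j, Real.exp (c i j * a j))]
  refine Finset.prod_congr rfl fun i _ => ?_
  rw [integral_fintype_prod_eq_prod (fun j (k : ℕ) => Real.exp (c i j * k))]
  refine Finset.prod_congr rfl fun j _ => ?_
  rw [integral_exp_mul_poissonMeasure, Real.coe_toNNReal _ (by positivity)]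

/-- The coefficient of `X i j` in `∑ i, τ(i) h_i(σ)`, where `h` is the local field. -/
def fieldCoeff {n : ℕ} (τ σ : Fin n → Bool) (i j : Fin n) : ℝ :=
  if i = j then 0 else spin (τ i) * spin (σ j) + spin (τ j) * spin (σ i)

lemma abs_fieldCoeff_le {n : ℕ} (τ σ : Fin n → Bool) (i j : Fin n) : |fieldCoeff τ σ i j| ≤ 2 := by
  unfold fieldCoeff
  split_ifs
  · simp
  · refine (abs_add_le _ _).trans ?_
    rw [abs_mul, abs_mul]
    simp only [abs_spin]
    norm_num

lemma sum_spin_mul_localField {n : ℕ} (X : Fin n → Fin n → ℝ) (τ σ : Fin n → Bool) :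
    ∑ i, spin (τ i) * localField X σ i = ∑ i, ∑ j, fieldCoeff τ σ i j * X i j := by
  have h : ∀ i j, fieldCoeff τ σ i j * X i j =
      (if i = j then 0 else spin (τ i) * (X i j * spin (σ j))) +
      (if i = j then 0 else spin (τ j) * (X i j * spin (σ i))) := by
    intro i j
    unfold fieldCoeff
    split_ifs <;> ring
  simp only [h, Finset.sum_add_distrib]
  rw [Finset.sum_comm (f := fun i j => if i = j then 0 else spin (τ j) * (X i j * spin (σ i))),
    ← Finset.sum_add_distrib]
  refine Finset.sum_congr rfl fun i _ => ?_
  rw [localField, Finset.mul_sum, ← Finset.sum_add_distrib]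
  refine Finset.sum_congr rfl fun j _ => ?_
  by_cases hij : j = i
  · simp [hij]
  · simp [hij, Ne.symm hij]
    ring

lemma sum_fieldCoeff_le {n : ℕ} (τ σ : Fin n → Bool) :
    ∑ i, ∑ j, fieldCoeff τ σ i j ≤ 2 * ((∑ i, spin (τ i)) * ∑ i, spin (σ i)) + 2 * n := by
  have h : ∀ i j, fieldCoeff τ σ i j = spin (τ i) * spin (σ j) + spin (τ j) * spin (σ i) -
      if i = j then 2 * (spin (τ i) * spin (σ i)) else 0 := by
    intro i j
    unfold fieldCoeff
    split_ifs with hij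
    · subst hij; ring
    · ring
  simp only [h, Finset.sum_add_distrib, Finset.sum_sub_distrib, Finset.sum_ite_eq,
    Finset.mem_univ, if_true]
  rw [Finset.sum_comm (f := fun i j => spin (τ j) * spin (σ i)), ← Finset.sum_mul_sum,
    ← Finset.mul_sum]
  have : -∑ i, spin (τ i) * spin (σ i) ≤ n := by
    refine (neg_le_abs _).trans ((Finset.abs_sum_le_sum_abs _ _).trans ?_)
    simp [abs_mul, abs_spin]
  linarith

/-- Exponential moment of the linear forms in the fluctuation of the local fields. -/
lemma integral_exp_fluctuation_le {n : ℕ} (hn : 0 < n) {r : ℝ} (hr : 2 ≤ r)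
    (τ σ : Fin n → Bool) :
    ∫ A : Fin n → Fin n → ℕ, Real.exp (∑ i, ∑ j, fieldCoeff τ σ i j / r * (A i j : ℝ))
      ∂(sparseMeasure n (r ^ 2)) ≤
      Real.exp (r * magnetization σ * (∑ i, spin (τ i)) + r + 2 * n) := by
  have hr0 : 0 < r := by linarith
  have hn' : (0 : ℝ) < n := by exact_mod_cast hn
  rw [integral_exp_sum_sparseMeasure (by positivity)]
  refine Real.exp_le_exp.mpr ?_
  have hterm : ∀ i j, r ^ 2 / (2 * n) * (Real.exp (fieldCoeff τ σ i j / r) - 1) ≤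
      r / (2 * n) * fieldCoeff τ σ i j + 2 / n := by
    intro i j
    have hc := abs_fieldCoeff_le τ σ i j
    have h1 : |fieldCoeff τ σ i j / r| ≤ 1 := by
      rw [abs_div, abs_of_pos hr0, div_le_one hr0]
      linarith
    have h2 := (le_abs_self _).trans (Real.abs_exp_sub_one_sub_id_le h1)
    have h3 : (fieldCoeff τ σ i j) ^ 2 ≤ 4 := by
      rw [← sq_abs]
      nlinarith [abs_nonneg (fieldCoeff τ σ i j)]
    calc r ^ 2 / (2 * n) * (Real.exp (fieldCoeff τ σ i j / r) - 1)
        ≤ r ^ 2 / (2 * n) * (fieldCoeff τ σ i j / r + (fieldCoeff τ σ i j / r) ^ 2) := by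
          gcongr
          linarith
      _ = r / (2 * n) * fieldCoeff τ σ i j + (fieldCoeff τ σ i j) ^ 2 / (2 * n) := by
          field_simp
      _ ≤ r / (2 * n) * fieldCoeff τ σ i j + 4 / (2 * n) := by gcongr
      _ = _ := by ring
  refine (Finset.sum_le_sum fun i _ => Finset.sum_le_sum fun j _ => hterm i j).trans ?_
  simp only [Finset.sum_add_distrib, ← Finset.mul_sum]
  have h := mul_le_mul_of_nonneg_left (sum_fieldCoeff_le τ σ)
    (by positivity : (0 : ℝ) ≤ r / (2 * n))
  have e1 : r / (2 * n) * (2 * ((∑ i, spin (τ i)) * ∑ i, spin (σ i)) + 2 * n) =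
      r * magnetization σ * (∑ i, spin (τ i)) + r := by
    rw [magnetization]
    field_simp
  have e2 : ∑ _i : Fin n, ∑ _j : Fin n, (2 : ℝ) / n = 2 * n := by
    simp only [Finset.sum_const, Finset.card_univ, Fintype.card_fin, nsmul_eq_mul]
    field_simp
  rw [e1] at h
  rw [e2]
  linarith

lemma avg1_magnetization_sq_nonneg {n : ℕ} (b : ℝ) (X : Fin n → Fin n → ℝ) :
    0 ≤ avg1 b X (fun σ => magnetization σ ^ 2) :=
  Finset.sum_nonneg fun σ _ => mul_nonneg (sq_nonneg _) (gibbs_nonneg b X σ)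

lemma avg1_magnetization_sq_le_one {n : ℕ} (b : ℝ) (X : Fin n → Fin n → ℝ) :
    avg1 b X (fun σ => magnetization σ ^ 2) ≤ 1 :=
  (avg1_mono fun σ => (sq_le_one_iff_abs_le_one _).mpr (abs_magnetization_le_one σ)).trans_eq
    (avg1_const b X 1)

lemma exists_integral_avg1_magnetization_sq_le {β : ℝ} (hβ : 0 ≤ β) :
    ∃ K : ℝ, ∀ r : ℝ, 2 ≤ r → ∀ n : ℕ, 0 < n →
      ∫ A, avg1 (β / r) (natMat A) (fun σ => magnetization σ ^ 2) ∂(sparseMeasure n (r ^ 2)) ≤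
        K / r ^ 2 + K * r ^ 2 / n + Real.exp (r - n) := by
  obtain ⟨K, hK⟩ := exists_avg1_magnetization_sq_le hβ
  refine ⟨|K|, fun r hr n hn => ?_⟩
  have hr0 : 0 < r := by linarith
  have hn' : (0 : ℝ) < n := by exact_mod_cast hn
  set B : ℝ := |K| / r ^ 2 + |K| * r ^ 2 / n with hB
  have hB0 : 0 ≤ B := by positivity
  set w : (Fin n → Bool) → (Fin n → Bool) → ℝ := fun τ σ =>
    Real.exp (-(r * magnetization σ * (∑ i, spin (τ i))) - 5 * n) with hw
  set G : (Fin n → Bool) → (Fin n → Bool) → (Fin n → Fin n → ℕ) → ℝ := fun τ σ A =>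
    w τ σ * Real.exp (∑ i, ∑ j, fieldCoeff τ σ i j / r * (A i j : ℝ)) with hG
  have hG0 : ∀ τ σ A, 0 ≤ G τ σ A := fun τ σ A => by positivity
  have hGint : ∀ τ σ, Integrable (G τ σ) (sparseMeasure n (r ^ 2)) := fun τ σ =>
    (integrable_exp_sum_sparseMeasure _ _).const_mul _
  have hsumint : Integrable (fun A => B + ∑ τ, ∑ σ, G τ σ A) (sparseMeasure n (r ^ 2)) :=
    (integrable_const _).add
      (integrable_finsetSum _ fun τ _ => integrable_finsetSum _ fun σ _ => hGint τ σ)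
  have hpt : ∀ A : Fin n → Fin n → ℕ,
      avg1 (β / r) (natMat A) (fun σ => magnetization σ ^ 2) ≤ B + ∑ τ, ∑ σ, G τ σ A := by
    intro A
    by_cases hgood : ∀ σ, ∑ i, |localField (natMat A) σ i - r ^ 2 * magnetization σ| ≤ 5 * n * r
    · have h1 := hK r (by linarith) n hn (natMat A) hgood
      have h2 : K / r ^ 2 + K * r ^ 2 / n ≤ B := by
        rw [hB]
        gcongr <;> exact le_abs_self K
      have h3 : 0 ≤ ∑ τ, ∑ σ, G τ σ A :=
        Finset.sum_nonneg fun τ _ => Finset.sum_nonneg fun σ _ => hG0 τ σ A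
      linarith
    · push Not at hgood
      obtain ⟨σ, hσ⟩ := hgood
      let τ : Fin n → Bool := fun i =>
        decide (0 ≤ localField (natMat A) σ i - r ^ 2 * magnetization σ)
      have hτ : ∀ i, |localField (natMat A) σ i - r ^ 2 * magnetization σ| =
          spin (τ i) * localField (natMat A) σ i - r ^ 2 * magnetization σ * spin (τ i) := by
        intro i
        by_cases h : 0 ≤ localField (natMat A) σ i - r ^ 2 * magnetization σ
        · have : spin (τ i) = 1 := by simp only [τ, spin, h, decide_true, if_true]
          rw [abs_of_nonneg h, this]
          ring
        · have : spin (τ i) = -1 := by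
            simp only [τ, spin, h, decide_false, Bool.false_eq_true, if_false]
          rw [abs_of_neg (not_le.mp h), this]
          ring
      simp only [hτ, Finset.sum_sub_distrib, ← Finset.mul_sum, sum_spin_mul_localField] at hσ
      have h1 : 1 ≤ G τ σ A := by
        simp only [hG, hw]
        rw [← Real.exp_add, Real.one_le_exp_iff]
        have e : ∑ i, ∑ j, fieldCoeff τ σ i j / r * (A i j : ℝ) =
            (∑ i, ∑ j, fieldCoeff τ σ i j * natMat A i j) / r := by
          simp only [Finset.sum_div, natMat]
          refine Finset.sum_congr rfl fun i _ => Finset.sum_congr rfl fun j _ => ?_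
          ring
        have h2 : r * magnetization σ * (∑ i, spin (τ i)) + 5 * n ≤
            (∑ i, ∑ j, fieldCoeff τ σ i j * natMat A i j) / r := by
          rw [le_div_iff₀ hr0]
          nlinarith
        rw [e]
        linarith
      have h2 : G τ σ A ≤ ∑ τ, ∑ σ, G τ σ A :=
        (Finset.single_le_sum (f := fun σ => G τ σ A) (fun σ _ => hG0 τ σ A)
          (Finset.mem_univ σ)).trans
        (Finset.single_le_sum (f := fun τ => ∑ σ, G τ σ A)
          (fun τ _ => Finset.sum_nonneg fun σ _ => hG0 τ σ A) (Finset.mem_univ τ))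
      have h3 := avg1_magnetization_sq_le_one (β / r) (natMat A)
      linarith
  refine (integral_mono_of_nonneg (ae_of_all _ fun A => avg1_magnetization_sq_nonneg _ _)
    hsumint (ae_of_all _ hpt)).trans ?_
  rw [integral_add (integrable_const _)
    (integrable_finsetSum _ fun τ _ => integrable_finsetSum _ fun σ _ => hGint τ σ),
    integral_finsetSum _ fun τ _ => integrable_finsetSum _ fun σ _ => hGint τ σ]
  simp only [integral_const, probReal_univ, one_smul]
  gcongr
  have hGle : ∀ τ σ, ∫ A, G τ σ A ∂(sparseMeasure n (r ^ 2)) ≤ Real.exp (r - 3 * n) := by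
    intro τ σ
    refine (integral_const_mul _ _).trans_le ?_
    refine (mul_le_mul_of_nonneg_left (integral_exp_fluctuation_le hn hr τ σ)
      (Real.exp_pos _).le).trans_eq ?_
    rw [← Real.exp_add]
    congr 1
    ring
  have h2n : (2 : ℝ) ^ n ≤ Real.exp n := by
    rw [← mul_one (n : ℝ), Real.exp_nat_mul]
    gcongr
    linarith [Real.add_one_le_exp (1 : ℝ)]
  calc ∑ τ, ∫ A, ∑ σ, G τ σ A ∂(sparseMeasure n (r ^ 2))
      = ∑ τ, ∑ σ, ∫ A, G τ σ A ∂(sparseMeasure n (r ^ 2)) :=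
        Finset.sum_congr rfl fun τ _ => integral_finsetSum _ fun σ _ => hGint τ σ
    _ ≤ ∑ _τ : Fin n → Bool, ∑ _σ : Fin n → Bool, Real.exp (r - 3 * n) :=
        Finset.sum_le_sum fun τ _ => Finset.sum_le_sum fun σ _ => hGle τ σ
    _ = (2 : ℝ) ^ n * ((2 : ℝ) ^ n * Real.exp (r - 3 * n)) := by simp
    _ ≤ Real.exp n * (Real.exp n * Real.exp (r - 3 * n)) := by gcongr
    _ = Real.exp (r - n) := by
        rw [← Real.exp_add, ← Real.exp_add]
        congr 1
        ring

end

/-- the average squared magnetization of the sparse model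
vanishes faster than `1/√d`. -/
theorem stmt_14 (β : ℝ) (hβ : 0 ≤ β) :
    Tendsto (fun d : ℝ =>
      Real.sqrt d *
        limsup (fun n : ℕ =>
          ∫ A, avg1 (β / Real.sqrt d) (natMat A)
            (fun σ => ((1 / (n : ℝ)) * ∑ i, spin (σ i)) ^ 2) ∂(sparseMeasure n d)) atTop)
      atTop (nhds 0) := by
  obtain ⟨K, hK⟩ := exists_integral_avg1_magnetization_sq_le hβ
  have hlim : Tendsto (fun d : ℝ => K / Real.sqrt d) atTop (nhds 0) :=
    Real.tendsto_sqrt_atTop.const_div_atTop K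
  have hbound : ∀ d : ℝ, 4 ≤ d →
      0 ≤ limsup (fun n : ℕ => ∫ A, avg1 (β / Real.sqrt d) (natMat A)
        (fun σ => ((1 / (n : ℝ)) * ∑ i, spin (σ i)) ^ 2) ∂(sparseMeasure n d)) atTop ∧
      limsup (fun n : ℕ => ∫ A, avg1 (β / Real.sqrt d) (natMat A)
        (fun σ => ((1 / (n : ℝ)) * ∑ i, spin (σ i)) ^ 2) ∂(sparseMeasure n d)) atTop ≤ K / d := by
    intro d hd
    have hr : 2 ≤ Real.sqrt d := Real.le_sqrt_of_sq_le (by linarith)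
    have hsq : Real.sqrt d ^ 2 = d := Real.sq_sqrt (by linarith)
    set u : ℕ → ℝ := fun n : ℕ => ∫ A, avg1 (β / Real.sqrt d) (natMat A)
        (fun σ => ((1 / (n : ℝ)) * ∑ i, spin (σ i)) ^ 2) ∂(sparseMeasure n d) with hu
    set v : ℕ → ℝ := fun n : ℕ => K / d + K * d / n + Real.exp (Real.sqrt d - n) with hv
    have huv : u ≤ᶠ[atTop] v := by
      filter_upwards [eventually_gt_atTop 0] with n hn
      have h := hK (Real.sqrt d) hr n hn
      rw [hsq] at h
      exact h
    have hu0 : ∀ n, 0 ≤ u n := fun n =>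
      integral_nonneg fun A => avg1_magnetization_sq_nonneg _ _
    have hvlim : Tendsto v atTop (nhds (K / d)) := by
      have h1 : Tendsto (fun n : ℕ => K * d / (n : ℝ)) atTop (nhds 0) :=
        tendsto_natCast_atTop_atTop.const_div_atTop _
      have h2 : Tendsto (fun n : ℕ => Real.exp (Real.sqrt d - n)) atTop (nhds 0) :=
        Real.tendsto_exp_atBot.comp
          (tendsto_atBot_add_const_left _ _
            (tendsto_neg_atTop_atBot.comp tendsto_natCast_atTop_atTop))
      simpa using (h1.const_add (K / d)).add h2
    have hub : IsBoundedUnder (· ≤ ·) atTop u := hvlim.isBoundedUnder_le.mono_le huv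
    have hulb : IsBoundedUnder (· ≥ ·) atTop u := isBoundedUnder_of ⟨0, hu0⟩
    refine ⟨le_limsup_of_frequently_le (Frequently.of_forall hu0) hub, ?_⟩
    rw [← hvlim.limsup_eq]
    exact limsup_le_limsup huv hulb.isCoboundedUnder_le hvlim.isBoundedUnder_le
  refine tendsto_of_tendsto_of_tendsto_of_le_of_le' tendsto_const_nhds hlim ?_ ?_
  · filter_upwards [eventually_ge_atTop 4] with d hd
    exact mul_nonneg (Real.sqrt_nonneg d) (hbound d hd).1
  · filter_upwards [eventually_ge_atTop 4] with d hd
    have hr : 0 < Real.sqrt d := Real.sqrt_pos.mpr (by linarith)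
    calc _ ≤ Real.sqrt d * (K / d) := mul_le_mul_of_nonneg_left (hbound d hd).2 hr.le
      _ = K / Real.sqrt d := by
        nth_rewrite 2 [← Real.mul_self_sqrt (by linarith : (0 : ℝ) ≤ d)]
        field_simp
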